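/- arXiv:2412.20661 — 2 statements merged into one kernel-verified Lean document; each statement's English description precedes it below -/
import Mathlib

section
/- Let T be a finite combinatorial tree on n nodes with shortest path distance matrix D (D_{ij} = d(i,j)). Define κ ∈ ℝ^n by κ_j = (n/(n−1))·(2 − deg(j)). Then D·κ = n·1, i.e., for every node i, ∑_{j ∈ V} d(i,j)·(n/(n−1))·(2 − deg(j)) = n. -/
theorem SimpleGraph.IsTree.existsUnique_adj_dist_add_one_eq {V : Type*} {G : SimpleGraph V}
    (hT : G.IsTree) {u v : V} (huv : v ≠ u) :
    ∃! w, G.Adj v w ∧ G.dist u w + 1 = G.dist u v := by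
  obtain ⟨p, hp, hlen⟩ := hT.connected.exists_path_of_dist u v
  have hnil : ¬ p.Nil := fun h => huv h.eq.symm
  have key : ∀ w, G.Adj v w → G.dist u w + 1 = G.dist u v → w = p.penultimate := by
    intro w hadj hw
    obtain ⟨q, hq⟩ := hT.connected.exists_walk_length_eq_dist u w
    have hpath : (q.concat hadj.symm).IsPath := by
      apply SimpleGraph.Walk.isPath_of_length_eq_dist
      rw [SimpleGraph.Walk.length_concat, hq, hw]
    have := (hT.existsUnique_path u v).unique hp hpath
    rw [this, SimpleGraph.Walk.penultimate_concat]
  refine ⟨p.penultimate, ⟨(p.adj_penultimate hnil).symm, ?_⟩, fun w hw => key w hw.1 hw.2⟩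
  have h1 : G.dist u p.penultimate ≤ p.length - 1 := by
    simpa using SimpleGraph.dist_le p.dropLast
  have hpos := hT.connected.pos_dist_of_ne huv.symm
  rcases hT.dist_eq_dist_add_one_of_adj u (p.adj_penultimate hnil) with h | h <;> omega

theorem SimpleGraph.IsTree.sum_dist_mul_two_sub_degree {V : Type*} [Fintype V] [DecidableEq V]
    {G : SimpleGraph V} [DecidableRel G.Adj] (hT : G.IsTree) (u : V) :
    ∑ v, (G.dist u v : ℝ) * (2 - (G.degree v : ℝ)) = (Fintype.card V : ℝ) - 1 := by
  have hparent : ∀ v, (∑ w, if G.Adj v w ∧ G.dist u w + 1 = G.dist u v then (1 : ℝ) else 0) =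
      if v = u then 0 else 1 := by
    intro v
    split_ifs with hv
    · subst hv
      simp
    · obtain ⟨w, hw, huniq⟩ := hT.existsUnique_adj_dist_add_one_eq hv
      rw [Finset.sum_eq_single w, if_pos hw]
      · exact fun x _ hx => if_neg fun h => hx (huniq x h)
      · simp
  have hdeg : ∀ v, (G.degree v : ℝ) = ∑ w, if G.Adj v w then (1 : ℝ) else 0 := by
    intro v
    rw [Finset.sum_boole, ← G.neighborFinset_eq_filter, G.card_neighborFinset_eq_degree]
  have hsplit : ∀ v w, (G.dist u v : ℝ) * (if G.Adj v w then (1 : ℝ) else 0) =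
      (G.dist u v : ℝ) * (if G.Adj v w ∧ G.dist u w + 1 = G.dist u v then (1 : ℝ) else 0) +
      ((G.dist u w : ℝ) - 1) *
        (if G.Adj w v ∧ G.dist u v + 1 = G.dist u w then (1 : ℝ) else 0) := by
    intro v w
    by_cases hadj : G.Adj v w
    · rcases hT.dist_eq_dist_add_one_of_adj u hadj with h | h
      · simp [hadj, hadj.symm, h, add_assoc]
      · simp [hadj, hadj.symm, h, add_assoc]
    · simp [hadj, G.adj_comm w v]
  have hsum : ∑ v, (G.dist u v : ℝ) * (G.degree v : ℝ) =
      ∑ v, (2 * (G.dist u v : ℝ) - 1) * (if v = u then 0 else 1) := by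
    simp_rw [hdeg, Finset.mul_sum, hsplit, Finset.sum_add_distrib]
    rw [Finset.sum_comm (f := fun v w => ((G.dist u w : ℝ) - 1) * _)]
    simp_rw [← Finset.mul_sum, hparent, ← Finset.sum_add_distrib]
    exact Finset.sum_congr rfl fun v _ => by ring
  have hterm : ∀ v, (2 * (G.dist u v : ℝ) - 1) * (if v = u then 0 else 1) =
      (G.dist u v : ℝ) * 2 - 1 + if v = u then 1 else 0 := by
    intro v
    split_ifs with hv
    · simp [hv]
    · ring
  simp_rw [mul_sub]
  rw [Finset.sum_sub_distrib, hsum]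
  simp_rw [hterm, Finset.sum_add_distrib, Finset.sum_sub_distrib]
  simp only [Finset.sum_const, Finset.card_univ, nsmul_eq_mul, mul_one, Finset.sum_ite_eq',
    Finset.mem_univ, if_true]
  ring

theorem stmt_1 {V : Type*} [Fintype V] [DecidableEq V] (G : SimpleGraph V)
    [DecidableRel G.Adj] (hT : G.IsTree) (hn : 2 ≤ Fintype.card V) :
    ∀ i : V, ∑ j, (G.dist i j : ℝ) *
        ((Fintype.card V : ℝ) / ((Fintype.card V : ℝ) - 1) * (2 - (G.degree j : ℝ))) =
      (Fintype.card V : ℝ) := by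
  intro i
  have hne : (Fintype.card V : ℝ) - 1 ≠ 0 := by
    have : (2 : ℝ) ≤ Fintype.card V := by exact_mod_cast hn
    linarith
  simp_rw [mul_left_comm (G.dist i _ : ℝ)]
  rw [← Finset.mul_sum, hT.sum_dist_mul_two_sub_degree i, div_mul_cancel₀ _ hne]
end

section
/- The distance matrix D of a finite combinatorial tree on n ≥ 2 nodes, with entries D_{ij} = d(i,j), is nonsingular (invertible). -/
namespace SimpleGraph

variable {V : Type*} {G : SimpleGraph V}

/-- In a tree rooted at `i`, every `j ≠ i` has a unique parent, and its other neighbours are its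
children. -/
lemma IsTree.exists_parent (hT : G.IsTree) {i j : V} (hij : j ≠ i) :
    ∃ a, G.Adj j a ∧ G.dist i a + 1 = G.dist i j ∧
      ∀ k, G.Adj j k → k ≠ a → G.dist i k = G.dist i j + 1 := by
  have key : ∀ a, G.Adj j a → G.dist i a + 1 = G.dist i j →
      ∃ (h : G.Adj j a) (p : G.Walk a i), (Walk.cons h p).IsPath := by
    intro a h hd
    obtain ⟨p, hp⟩ := hT.connected.exists_walk_length_eq_dist a i
    refine ⟨h, p, Walk.isPath_of_length_eq_dist _ ?_⟩
    rw [Walk.length_cons, hp, dist_comm, hd, dist_comm]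
  obtain ⟨p, hp⟩ := hT.connected.exists_walk_length_eq_dist j i
  cases p with
  | nil => exact absurd rfl hij
  | @cons _ a _ h p =>
    have ha : G.dist i a + 1 = G.dist i j := by
      have h₁ := dist_le p
      rw [Walk.length_cons, dist_comm] at hp
      rw [dist_comm] at h₁
      have h₂ := hT.dist_eq_dist_add_one_of_adj i h
      omega
    refine ⟨a, h, ha, fun k hk hka => ?_⟩
    rcases hT.dist_eq_dist_add_one_of_adj i hk with h' | h'
    · obtain ⟨_, q, hq⟩ := key k hk h'.symm
      obtain ⟨_, r, hr⟩ := key a h ha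
      have := (hT.isAcyclic.subsingleton_path j i).elim ⟨_, hq⟩ ⟨_, hr⟩
      rw [Subtype.mk.injEq, Walk.cons.injEq] at this
      exact absurd this.1 hka
    · exact h'

variable [Fintype V] [DecidableRel G.Adj]

/-- Summing a function of the distance to `i` over the neighbours of `j ≠ i` in a tree. -/
lemma IsTree.sum_neighborFinset_dist (hT : G.IsTree) {i j : V} (hij : j ≠ i) (g : ℝ → ℝ) :
    ∑ k ∈ G.neighborFinset j, g (G.dist i k) =
      (G.degree j - 1) * g (G.dist i j + 1) + g (G.dist i j - 1) := by
  classical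
  obtain ⟨a, ha, had, hk⟩ := hT.exists_parent hij
  have hmem : a ∈ G.neighborFinset j := by simpa using ha
  have had' : (G.dist i a : ℝ) = G.dist i j - 1 := by rw [← had]; push_cast; ring
  have hcard : (((G.neighborFinset j).erase a).card : ℝ) = G.degree j - 1 := by
    rw [← G.card_neighborFinset_eq_degree j, ← Finset.card_erase_add_one hmem]
    push_cast; ring
  rw [← Finset.sum_erase_add _ _ hmem, had', ← hcard, ← nsmul_eq_mul]
  congr 1
  refine Finset.sum_eq_card_nsmul fun k hk' => ?_
  rw [Finset.mem_erase, mem_neighborFinset] at hk'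
  rw [hk k hk'.2 hk'.1]
  push_cast; rfl

lemma sum_neighborFinset_dist_self (i : V) (g : ℝ → ℝ) :
    ∑ k ∈ G.neighborFinset i, g (G.dist i k) = G.degree i * g 1 := by
  rw [← G.card_neighborFinset_eq_degree i, ← nsmul_eq_mul]
  refine Finset.sum_eq_card_nsmul fun k hk => ?_
  rw [mem_neighborFinset] at hk
  rw [dist_eq_one_iff_adj.mpr hk, Nat.cast_one]

lemma sum_sum_neighborFinset (f : V → ℝ) :
    ∑ j, ∑ k ∈ G.neighborFinset j, f k = ∑ j, G.degree j * f j := by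
  rw [Finset.sum_comm' (t' := Finset.univ) (s' := fun k => G.neighborFinset k)
    (by simp [adj_comm])]
  simp

lemma IsTree.two_mul_sum_dist_mul_two_sub_degree (hT : G.IsTree) (i : V) :
    2 * ∑ j, (G.dist i j : ℝ) * (2 - G.degree j) = ∑ j, (G.degree j : ℝ) := by
  have h := G.sum_sum_neighborFinset fun k => (G.dist i k : ℝ) ^ 2
  have h' : ∀ j, ∑ k ∈ G.neighborFinset j, (G.dist i k : ℝ) ^ 2 =
      G.degree j * (G.dist i j + 1) ^ 2 - 4 * G.dist i j := by
    intro j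
    by_cases hij : j = i
    · subst hij
      rw [sum_neighborFinset_dist_self j (· ^ 2)]
      simp
    · rw [hT.sum_neighborFinset_dist hij (· ^ 2)]
      ring
  simp_rw [h'] at h
  rw [← sub_eq_zero, ← Finset.sum_sub_distrib] at h
  rw [← sub_eq_zero, Finset.mul_sum, ← Finset.sum_sub_distrib, ← neg_eq_zero, ← h,
    ← Finset.sum_neg_distrib]
  exact Finset.sum_congr rfl fun j _ => by ring

lemma IsTree.degree_mul_dist_sub_sum [DecidableEq V] (hT : G.IsTree) (i j : V) :
    G.degree j * (G.dist i j : ℝ) - ∑ k ∈ G.neighborFinset j, (G.dist i k : ℝ) =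
      (2 - G.degree j) - if j = i then 2 else 0 := by
  split_ifs with hij
  · subst hij
    rw [sum_neighborFinset_dist_self j fun t => t]
    simp
  · rw [hT.sum_neighborFinset_dist hij fun t => t]
    ring

/-- A kernel vector of the distance matrix of a tree is a multiple of `2 - degree`. -/
lemma IsTree.two_mul_eq_of_sum_dist_mul_eq_zero [DecidableEq V] (hT : G.IsTree) {x : V → ℝ}
    (hx : ∀ j, ∑ i, (G.dist j i : ℝ) * x i = 0) (j : V) :
    2 * x j = (∑ i, x i) * (2 - G.degree j) := by
  have h : ∑ i, (G.degree j * (G.dist i j : ℝ) -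
      ∑ k ∈ G.neighborFinset j, (G.dist i k : ℝ)) * x i = 0 := by
    simp_rw [sub_mul, Finset.sum_mul, Finset.sum_sub_distrib, mul_assoc, ← Finset.mul_sum]
    rw [Finset.sum_comm]
    simp_rw [G.dist_comm (v := j), hx]
    rw [Finset.sum_eq_zero (s := G.neighborFinset j), mul_zero, sub_zero]
    intro k _
    simp_rw [G.dist_comm (v := k), hx]
  simp_rw [hT.degree_mul_dist_sub_sum, sub_mul _ (ite _ _ _), Finset.sum_sub_distrib,
    ← Finset.mul_sum] at h
  simp only [ite_mul, zero_mul, Finset.sum_ite_eq, Finset.mem_univ, if_true] at h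
  linarith

end SimpleGraph

theorem stmt_3 {V : Type*} [Fintype V] [DecidableEq V] (G : SimpleGraph V)
    (hT : G.IsTree) (hn : 2 ≤ Fintype.card V) :
    IsUnit (Matrix.of fun i j : V => (G.dist i j : ℝ)) := by
  classical
  rw [← Matrix.mulVec_injective_iff_isUnit, ← Matrix.coe_mulVecLin, injective_iff_map_eq_zero]
  intro x hx
  have hx' : ∀ j, ∑ i, (G.dist j i : ℝ) * x i = 0 := fun j => congrFun hx j
  have hdeg := hT.two_mul_eq_of_sum_dist_mul_eq_zero hx'
  have : Nontrivial V := Fintype.one_lt_card_iff_nontrivial.mp hn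
  obtain ⟨v⟩ := hT.connected.nonempty
  have hpos : 0 < ∑ j, (G.degree j : ℝ) :=
    Finset.sum_pos
      (fun j _ => Nat.cast_pos.mpr (hT.connected.preconnected.degree_pos_of_nontrivial j))
      ⟨v, Finset.mem_univ v⟩
  have hs : (∑ i, x i) * ∑ j, (G.degree j : ℝ) = 0 := by
    rw [← hT.two_mul_sum_dist_mul_two_sub_degree v, mul_left_comm, Finset.mul_sum]
    simp_rw [mul_left_comm (∑ i, x i), ← hdeg, mul_left_comm _ (2 : ℝ), ← Finset.mul_sum, hx' v]
    simp
  have hs' := (mul_eq_zero.mp hs).resolve_right hpos.ne'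
  ext j
  have := hdeg j
  rw [hs', zero_mul] at this
  simpa using this
end
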